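/- Let A, B be unital C*-algebras and φ : B → A a linear unital map. Then φ is positive if and only if ‖φ‖ ≤ 1. -/

import Mathlib

open Finset

lemma aux_orth {N : ℕ} {ζ : ℂ} (hζ : IsPrimitiveRoot ζ N) (h1 : ζ * star ζ = 1)
    {k l : ℕ} (hk : k < N) (hl : l < N) :
    ∑ j ∈ range N, (ζ ^ j) ^ k * (star (ζ ^ j)) ^ l = if k = l then (N : ℂ) else 0 := by
  have e : ∀ j, (ζ ^ j) ^ k * (star (ζ ^ j)) ^ l = (ζ ^ k * (star ζ) ^ l) ^ j := by
    intro j; rw [star_pow]; ring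
  simp only [e]
  split_ifs with h
  · subst h
    simp only [← mul_pow, h1, one_pow]
    simp
  · have hr : ζ ^ k * (star ζ) ^ l ≠ 1 := by
      intro hr
      apply h
      apply hζ.pow_inj hk hl
      calc ζ ^ k = ζ ^ k * (ζ * star ζ) ^ l := by rw [h1]; simp
        _ = (ζ ^ k * (star ζ) ^ l) * ζ ^ l := by ring
        _ = _ := by rw [hr, one_mul]
    have hN : (ζ ^ k * (star ζ) ^ l) ^ N = 1 := by
      have : (star ζ) ^ N = 1 := by rw [← star_pow, hζ.pow_eq_one, star_one]
      calc _ = (ζ ^ N) ^ k * ((star ζ) ^ N) ^ l := by ring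
        _ = 1 := by rw [this, hζ.pow_eq_one]; simp
    rw [geom_sum_eq hr, hN]; simp

lemma aux_contr {A ι : Type*} [CStarAlgebra A] [PartialOrder A] [StarOrderedRing A]
    (s : Finset ι) (a : ι → A) (ha : ∀ i ∈ s, 0 ≤ a i) (c : ι → ℂ)
    (hc : ∀ i, star (c i) * c i = 1) (h1 : ∑ i ∈ s, a i = 1) :
    ‖∑ i ∈ s, c i • a i‖ ≤ 1 := by
  set t := ∑ i ∈ s, c i • a i with ht
  have hst : star t = ∑ i ∈ s, star (c i) • a i := by
    rw [ht, star_sum]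
    refine Finset.sum_congr rfl fun i hi => ?_
    rw [star_smul, (ha i hi).isSelfAdjoint.star_eq]
  have hpos : 0 ≤ ∑ i ∈ s, star (c i • (1 : A) - t) * a i * (c i • (1 : A) - t) :=
    Finset.sum_nonneg fun i hi => star_left_conjugate_nonneg (ha i hi) _
  have heq : ∑ i ∈ s, star (c i • (1 : A) - t) * a i * (c i • (1 : A) - t) = 1 - star t * t := by
    have : ∀ i ∈ s, star (c i • (1 : A) - t) * a i * (c i • (1 : A) - t)
        = a i - (star (c i) • a i) * t - star t * (c i • a i) + star t * a i * t := by
      intro i _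
      have : a i = (star (c i) * c i) • a i := by rw [hc]; simp
      conv_rhs => enter [1, 1, 1]; rw [this]
      simp only [star_sub, star_smul, star_one, sub_mul, mul_sub, smul_mul_assoc, mul_smul_comm,
        one_mul, mul_one, mul_smul, smul_sub]
      rw [smul_comm (c i) (star (c i))]
      abel
    rw [Finset.sum_congr rfl this, Finset.sum_add_distrib, Finset.sum_sub_distrib,
      Finset.sum_sub_distrib, ← Finset.sum_mul, ← Finset.sum_mul, ← Finset.mul_sum,
      ← Finset.mul_sum, h1, ← hst, ← ht]
    simp
  rw [heq, sub_nonneg, ← CStarAlgebra.norm_le_one_iff_of_nonneg (star t * t) (star_mul_self_nonneg t),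
    CStarRing.norm_star_mul_self] at hpos
  nlinarith [norm_nonneg t]

lemma aux_fejer {B : Type*} [CStarAlgebra B] (u : B) (hu : u ∈ unitary B) (m : ℕ) :
    ∃ (c : ℕ → ℂ) (y : ℕ → B), (∀ i, star (c i) * c i = 1) ∧
      ∑ j ∈ range (m + 2), star (y j) * y j = (((m + 2) * (m + 1) : ℝ) : ℂ) • (1 : B) ∧
      ∑ j ∈ range (m + 2), c j • (star (y j) * y j) = (((m + 2) * m : ℝ) : ℂ) • u := by
  obtain ⟨ζ, hζ⟩ : ∃ ζ : ℂ, IsPrimitiveRoot ζ (m + 2) :=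
    ⟨_, Complex.isPrimitiveRoot_exp (m + 2) (by omega)⟩
  have hn : ‖ζ‖ = 1 := hζ.norm'_eq_one (by omega)
  have h1 : ζ * star ζ = 1 := by
    have := Complex.mul_conj' ζ
    rw [hn] at this
    simpa using this
  have huu : ∀ k, (star u) ^ k * u ^ k = 1 := by
    intro k
    rw [← star_pow]; exact (Unitary.mem_iff.1 (pow_mem hu k)).1
  have hyy : ∀ j, star (∑ k ∈ range (m + 1), (star (ζ ^ j)) ^ k • u ^ k) *
      (∑ k ∈ range (m + 1), (star (ζ ^ j)) ^ k • u ^ k) =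
      ∑ k ∈ range (m + 1), ∑ l ∈ range (m + 1),
        ((ζ ^ j) ^ k * (star (ζ ^ j)) ^ l) • ((star u) ^ k * u ^ l) := by
    intro j
    rw [star_sum, Finset.sum_mul_sum]
    refine Finset.sum_congr rfl fun k _ => Finset.sum_congr rfl fun l _ => ?_
    rw [star_smul, star_pow, star_star, smul_mul_smul_comm, star_pow u]
  refine ⟨fun j => ζ ^ j, fun j => ∑ k ∈ range (m + 1), (star (ζ ^ j)) ^ k • u ^ k, ?_, ?_, ?_⟩
  · intro i
    simp only [star_pow]; rw [← mul_pow, mul_comm, h1, one_pow]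
  · simp only [hyy]
    rw [Finset.sum_comm]
    have : ∀ k ∈ range (m + 1), ∑ j ∈ range (m + 2), ∑ l ∈ range (m + 1),
        ((ζ ^ j) ^ k * (star (ζ ^ j)) ^ l) • ((star u) ^ k * u ^ l) =
        ((m + 2 : ℝ) : ℂ) • (1 : B) := by
      intro k hk
      rw [Finset.sum_comm]
      rw [Finset.sum_eq_single_of_mem k hk]
      · rw [← Finset.sum_smul, aux_orth hζ h1 (by simp at hk; omega) (by simp at hk; omega), huu]
        simp
      · intro l hl hne
        rw [← Finset.sum_smul, aux_orth hζ h1 (by simp at hk; omega) (by simp at hl; omega),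
          if_neg hne.symm, zero_smul]
    rw [Finset.sum_congr rfl this, Finset.sum_const, card_range, ← Nat.cast_smul_eq_nsmul ℂ,
      smul_smul]
    congr 1; push_cast; ring
  · simp only [hyy, Finset.smul_sum, smul_smul]
    rw [Finset.sum_comm, Finset.sum_range_succ]
    have hs : ∀ k l j, ζ ^ j * ((ζ ^ j) ^ k * (star (ζ ^ j)) ^ l)
        = (ζ ^ j) ^ (k + 1) * (star (ζ ^ j)) ^ l := by intros; ring
    simp only [hs]
    have : ∀ k ∈ range m, ∑ j ∈ range (m + 2), ∑ l ∈ range (m + 1),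
        ((ζ ^ j) ^ (k + 1) * (star (ζ ^ j)) ^ l) • ((star u) ^ k * u ^ l) =
        ((m + 2 : ℝ) : ℂ) • u := by
      intro k hk
      rw [Finset.sum_comm]
      rw [Finset.sum_eq_single_of_mem (k + 1) (by simp at hk ⊢; omega)]
      · rw [← Finset.sum_smul, aux_orth hζ h1 (by simp at hk; omega) (by simp at hk; omega),
          pow_succ u, ← mul_assoc, huu]
        simp
      · intro l hl hne
        rw [← Finset.sum_smul, aux_orth hζ h1 (by simp at hk; omega) (by simp at hl; omega),
          if_neg hne.symm, zero_smul]
    have h2 : ∑ j ∈ range (m + 2), ∑ l ∈ range (m + 1),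
        ((ζ ^ j) ^ (m + 1) * (star (ζ ^ j)) ^ l) • ((star u) ^ m * u ^ l) = 0 := by
      rw [Finset.sum_comm]
      refine Finset.sum_eq_zero fun l hl => ?_
      rw [← Finset.sum_smul, aux_orth hζ h1 (by omega) (by simp at hl; omega),
          if_neg (by simp at hl; omega), zero_smul]
    rw [h2, Finset.sum_congr rfl this, Finset.sum_const, card_range, ← Nat.cast_smul_eq_nsmul ℂ,
      smul_smul, add_zero]
    congr 1; push_cast; ring

lemma aux_unitary {A B : Type*} [CStarAlgebra A] [PartialOrder A] [StarOrderedRing A]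
    [CStarAlgebra B] (φ : B →L[ℂ] A) (h1 : φ 1 = 1)
    (hpos : ∀ y : B, 0 ≤ φ (star y * y)) (u : B) (hu : u ∈ unitary B) : ‖φ u‖ ≤ 1 := by
  have key : ∀ m : ℕ, (m : ℝ) * ‖φ u‖ ≤ m + 1 := by
    intro m
    obtain ⟨c, y, hc, hy1, hy2⟩ := aux_fejer u hu m
    set r : ℝ := ((m + 2) * (m + 1) : ℝ)⁻¹ with hr
    have hr0 : 0 ≤ r := by positivity
    have h := aux_contr (range (m + 2)) (fun j => r • φ (star (y j) * y j))
      (fun j _ => smul_nonneg hr0 (hpos _)) c hc (by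
        rw [← Finset.smul_sum, ← map_sum, hy1, map_smul, h1, Complex.coe_smul, smul_smul, hr,
          inv_mul_cancel₀ (by positivity), one_smul])
    have h2 : ∑ i ∈ range (m + 2), c i • r • φ (star (y i) * y i) = (r * ((m + 2) * m)) • φ u := by
      simp only [smul_comm _ r]
      rw [← Finset.smul_sum]
      simp only [← map_smul φ]
      rw [← map_sum, hy2, map_smul, Complex.coe_smul, smul_smul]
    rw [h2, norm_smul, Real.norm_of_nonneg (by positivity), hr] at h
    have h3 : ((m + 2) * (m + 1) : ℝ)⁻¹ * ((m + 2) * m) = m / (m + 1) := by field_simp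
    rw [h3, div_mul_eq_mul_div, div_le_one (by positivity)] at h
    exact h
  by_contra! hlt
  obtain ⟨m, hm⟩ := exists_nat_gt (1 / (‖φ u‖ - 1))
  have := key m
  rw [div_lt_iff₀ (by linarith)] at hm
  linarith

lemma aux_polar {B : Type*} [CStarAlgebra B] (y : B) (hy : IsUnit y) (hn : ‖y‖ ≤ 1) :
    ∃ w₁ ∈ unitary B, ∃ w₂ ∈ unitary B, y + y = w₁ + w₂ := by
  let _ := CStarAlgebra.spectralOrder B
  let _ := CStarAlgebra.spectralOrderedRing B
  have hh := CFC.abs_mul_abs y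
  have hh0 : IsSelfAdjoint (CFC.abs y) := (CFC.abs_nonneg y).isSelfAdjoint
  set h := CFC.abs y
  have hu : IsUnit (h * h) := hh ▸ hy.star.mul hy
  have hhu : IsUnit h := ((Commute.refl h).isUnit_mul_iff.1 hu).1
  obtain ⟨k, hk⟩ := hhu
  have hki : star (↑k⁻¹ : B) = ↑k⁻¹ := by
    have h2 : star k = k := Units.ext (by rw [Units.coe_star, hk, hh0.star_eq])
    rw [← Units.coe_star, star_inv, h2]
  have hw : y * ↑k⁻¹ ∈ unitary B := by
    apply IsUnit.mem_unitary_of_star_mul_self (hy.mul k⁻¹.isUnit)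
    rw [star_mul, hki, mul_assoc, ← mul_assoc (star y), ← hh, ← hk]
    simp [mul_assoc]
  have hhn : ‖h‖ ≤ 1 := by
    have : ‖h * h‖ = ‖star y * y‖ := by rw [hh]
    rw [hh0.norm_mul_self, CStarRing.norm_star_mul_self] at this
    nlinarith [norm_nonneg h, norm_nonneg y]
  have he := hh0.self_add_I_smul_cfcSqrt_sub_sq_mem_unitary h hhn
  refine ⟨_, mul_mem hw he, _, mul_mem hw (Unitary.star_mem he), ?_⟩
  have hs : IsSelfAdjoint (CFC.sqrt (1 - h ^ 2)) := (CFC.sqrt_nonneg _).isSelfAdjoint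
  rw [← mul_add, star_add, star_smul, hs.star_eq, hh0.star_eq]
  have : (h + Complex.I • CFC.sqrt (1 - h ^ 2) + (h + star Complex.I • CFC.sqrt (1 - h ^ 2)))
      = h + h := by
    have : star Complex.I = - Complex.I := Complex.conj_I
    rw [this]; module
  rw [this, mul_add, mul_assoc, ← hk, Units.inv_mul, mul_one]

lemma aux_two {B : Type*} [CStarAlgebra B] (a : B) (ha : ‖a‖ < 1) (v : B) (hv : v ∈ unitary B) :
    ∃ w₁ ∈ unitary B, ∃ w₂ ∈ unitary B, v + a = w₁ + w₂ := by
  obtain (_ | _) := subsingleton_or_nontrivial B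
  · exact ⟨1, one_mem _, 1, one_mem _, Subsingleton.elim _ _⟩
  have hsv : ‖star v * a‖ < 1 := by
    rw [CStarRing.norm_mem_unitary_mul a (Unitary.star_mem hv)]; exact ha
  have h1 : IsUnit (v + a) := by
    have h2 : v + a = v * (1 - -(star v * a)) := by
      rw [sub_neg_eq_add, mul_add, ← mul_assoc, (Unitary.mem_iff.1 hv).2]; simp
    rw [h2]
    exact (Unitary.isUnit_coe (U := ⟨v, hv⟩)).mul
      (isUnit_one_sub_of_norm_lt_one (by rwa [norm_neg]))
  have h2 : IsUnit ((2⁻¹ : ℂ) • (v + a)) :=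
    h1.smul (Units.mk0 (2⁻¹ : ℂ) (by norm_num))
  obtain ⟨w₁, h₁, w₂, h₂, h⟩ := aux_polar _ h2 (by
    rw [norm_smul]
    have := norm_add_le v a
    rw [CStarRing.norm_of_mem_unitary hv] at this
    norm_num
    linarith)
  refine ⟨w₁, h₁, w₂, h₂, ?_⟩
  rw [← h]; module

lemma aux_pos_norm {A B : Type*} [CStarAlgebra A] [PartialOrder A] [StarOrderedRing A]
    [CStarAlgebra B] (φ : B →L[ℂ] A) (h1 : φ 1 = 1)
    (hpos : ∀ y : B, 0 ≤ φ (star y * y)) : ‖φ‖ ≤ 1 := by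
  have hu := aux_unitary φ h1 hpos
  have key : ∀ a : B, ‖a‖ < 1 → ∀ n : ℕ, ∀ v ∈ unitary B, ‖φ (v + n • a)‖ ≤ n + 1 := by
    intro a ha n
    induction n with
    | zero => intro v hv; simpa using hu v hv
    | succ n ih =>
      intro v hv
      obtain ⟨w₁, h₁, w₂, h₂, h⟩ := aux_two a ha v hv
      have : v + (n + 1) • a = w₁ + (w₂ + n • a) := by
        rw [← add_assoc, ← h, add_smul, one_smul]; abel
      rw [this, map_add]
      have := norm_add_le (φ w₁) (φ (w₂ + n • a))
      have := hu w₁ h₁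
      have := ih w₂ h₂
      push_cast
      linarith
  have hball : ∀ a : B, ‖a‖ < 1 → ‖φ a‖ ≤ 1 := by
    intro a ha
    by_contra! hlt
    obtain ⟨m, hm⟩ := exists_nat_gt (2 / (‖φ a‖ - 1))
    have h2 := key a ha m 1 (one_mem _)
    have h3 := hu 1 (one_mem _)
    have h4 : ‖m • φ a‖ = m * ‖φ a‖ := by
      rw [← Nat.cast_smul_eq_nsmul ℝ, norm_smul]; simp
    have h5 : m • φ a = φ (1 + m • a) - φ 1 := by
      rw [map_add, map_nsmul, add_sub_cancel_left]
    have h6 := norm_sub_le (φ (1 + m • a)) (φ 1)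
    rw [← h5, h4] at h6
    rw [div_lt_iff₀ (by linarith)] at hm
    linarith
  refine ContinuousLinearMap.opNorm_le_of_ball (ε := 1) one_pos zero_le_one fun a ha => ?_
  rw [mem_ball_zero_iff] at ha
  by_contra! hlt
  rw [one_mul] at hlt
  -- scale `a`
  obtain ⟨r, hr1, hr2⟩ := exists_between hlt
  have hr0 : 0 < r := (norm_nonneg a).trans_lt hr1
  have h := hball ((r⁻¹ : ℂ) • a) (by
    rw [norm_smul, norm_inv, Complex.norm_of_nonneg hr0.le, inv_mul_lt_iff₀ hr0]; simpa using hr1)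
  rw [map_smul, norm_smul, norm_inv, Complex.norm_of_nonneg hr0.le, inv_mul_le_iff₀ hr0] at h
  linarith

open scoped ComplexStarModule in
lemma aux_norm_pos {A B : Type*} [CStarAlgebra A] [PartialOrder A] [StarOrderedRing A]
    [CStarAlgebra B] [PartialOrder B] [StarOrderedRing B]
    (φ : B →L[ℂ] A) (h1 : φ 1 = 1) (hn : ‖φ‖ ≤ 1) (x : B) (hx : 0 ≤ x) : 0 ≤ φ x := by
  obtain (_ | _) := subsingleton_or_nontrivial A
  · exact (Subsingleton.elim _ _).le
  obtain (_ | _) := subsingleton_or_nontrivial B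
  · rw [Subsingleton.elim x 0]; simp
  have hle : ∀ z, ‖φ z‖ ≤ ‖z‖ := fun z => by
    simpa using φ.le_of_opNorm_le hn z
  have hxs : IsSelfAdjoint x := hx.isSelfAdjoint
  have hbd : ∀ t : ℝ, ‖(ℑ (φ x) : A) + algebraMap ℝ A t‖ ^ 2 ≤ ‖x‖ ^ 2 + t ^ 2 := by
    intro t
    set z : B := x + (Complex.I * t) • (1 : B) with hz
    have e1 : star z * z = x * x + ((t ^ 2 : ℝ) : ℂ) • (1 : B) := by
      have : star (Complex.I * (t : ℂ)) = - (Complex.I * t) := by simp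
      rw [hz, star_add, star_smul, hxs.star_eq, this]
      simp only [star_one, add_mul, mul_add, smul_mul_assoc, mul_smul_comm, one_mul, mul_one,
        smul_add, smul_smul]
      have h2 : Complex.I * (t : ℂ) * -(Complex.I * t) = ((t ^ 2 : ℝ) : ℂ) := by
        push_cast; linear_combination (-(t : ℂ) ^ 2) * Complex.I_sq
      rw [h2]
      module
    have e2 : ‖z‖ ^ 2 ≤ ‖x‖ ^ 2 + t ^ 2 := by
      rw [sq ‖z‖, ← CStarRing.norm_star_mul_self, e1]
      refine (norm_add_le _ _).trans ?_
      rw [hxs.norm_mul_self, norm_smul, Complex.norm_of_nonneg (sq_nonneg t)]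
      simp
    have e3 : (ℑ (φ z) : A) = (ℑ (φ x) : A) + algebraMap ℝ A t := by
      rw [hz, map_add, map_smul, h1, map_add, mul_smul, imaginaryPart_I_smul,
        Complex.coe_smul, Algebra.algebraMap_eq_smul_one]
      have : (ℜ (t • (1 : A)) : A) = t • 1 :=
        ((IsSelfAdjoint.all t).smul (IsSelfAdjoint.one A)).coe_realPart
      rw [AddSubgroup.coe_add, this]
    rw [← e3]
    have e4 : ‖(ℑ (φ z) : A)‖ ≤ ‖φ z‖ := by
      simpa using! imaginaryPart.norm_le (φ z)
    have := hle z
    have := norm_nonneg (ℑ (φ z) : A)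
    nlinarith
  have him : (ℑ (φ x) : A) = 0 := by
    apply CFC.eq_zero_of_spectrum_subset_zero (R := ℝ) _ _ (ℑ (φ x)).2
    intro b hb
    have hb2 : ∀ t : ℝ, (b + t) ^ 2 ≤ ‖x‖ ^ 2 + t ^ 2 := by
      intro t
      refine le_trans ?_ (hbd t)
      have := spectrum.norm_le_norm_of_mem ((spectrum.add_mem_add_iff (s := t)).2 hb)
      rw [add_comm (algebraMap ℝ A t)] at this
      rw [← sq_abs (b + t)]
      exact pow_le_pow_left₀ (abs_nonneg _) this 2
    by_contra hne
    have hne : b ≠ 0 := hne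
    have := hb2 (‖x‖ ^ 2 / b)
    have h3 : b * (‖x‖ ^ 2 / b) = ‖x‖ ^ 2 := by field_simp
    have h4 : 0 < b ^ 2 := by positivity
    nlinarith [sq_nonneg ‖x‖]
  have hsa : IsSelfAdjoint (φ x) := by
    rw [← realPart_add_I_smul_imaginaryPart (φ x), him]
    simp
  have hr : ‖algebraMap ℝ B ‖x‖ - x‖ ≤ ‖x‖ := by
    rw [CStarAlgebra.norm_le_iff_le_algebraMap _ (norm_nonneg x)
      (sub_nonneg.2 hxs.le_algebraMap_norm_self)]
    exact sub_le_self _ hx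
  have hr2 : ‖algebraMap ℝ A ‖x‖ - φ x‖ ≤ ‖x‖ := by
    refine le_trans (le_of_eq ?_) ((hle _).trans hr)
    rw [map_sub, Algebra.algebraMap_eq_smul_one, Algebra.algebraMap_eq_smul_one,
      ← Complex.coe_smul, ← Complex.coe_smul, map_smul, h1]
  have hsa2 : IsSelfAdjoint (algebraMap ℝ A ‖x‖ - φ x) :=
    (IsSelfAdjoint.algebraMap A (IsSelfAdjoint.all _)).sub hsa
  have h5 := hsa2.le_algebraMap_norm_self
  have h6 : algebraMap ℝ A ‖algebraMap ℝ A ‖x‖ - φ x‖ ≤ algebraMap ℝ A ‖x‖ :=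
    algebraMap_mono A hr2
  have h7 := h5.trans h6
  simpa using h7

/-- A unital bounded linear map between unital C*-algebras is positive
if and only if it has operator norm at most `1`. -/
theorem positive_iff_norm_le_one
    {A B : Type*}
    [NormedRing A] [StarRing A] [CStarRing A] [NormedAlgebra ℂ A] [StarModule ℂ A]
    [CompleteSpace A]
    [NormedRing B] [StarRing B] [CStarRing B] [NormedAlgebra ℂ B] [StarModule ℂ B]
    [CompleteSpace B]
    (φ : B →L[ℂ] A) (hunital : φ 1 = 1) :
    (∀ x : B, (∃ y : B, x = star y * y) → ∃ z : A, φ x = star z * z) ↔ ‖φ‖ ≤ 1 := by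
  let _ : CStarAlgebra A := {}
  let _ : CStarAlgebra B := {}
  let _ := CStarAlgebra.spectralOrder A
  have := CStarAlgebra.spectralOrderedRing A
  let _ := CStarAlgebra.spectralOrder B
  have := CStarAlgebra.spectralOrderedRing B
  constructor
  · intro h
    refine aux_pos_norm φ hunital fun y => ?_
    obtain ⟨z, hz⟩ := h _ ⟨y, rfl⟩
    rw [hz]
    exact star_mul_self_nonneg z
  · rintro h x ⟨y, rfl⟩
    exact CStarAlgebra.nonneg_iff_eq_star_mul_self.1
      (aux_norm_pos φ hunital h _ (star_mul_self_nonneg y))
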